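/- arXiv:1802.05441 — 2 statements merged into one kernel-verified Lean document; each statement's English description precedes it below -/
import Mathlib

section
/- Let 0 < n < 1 and T > 0. Let f : ℝ → ℝ be continuously differentiable on [0, T] with f(0) = 0. Then for every x ∈ [0, T], f(x) = (sin(nπ)/π) · ∫_{a=0}^{x} (x − a)^{n−1} · ( ∫_{z=0}^{a} f'(z)·(a − z)^{−n} dz ) da. (Equation (1) of Abel's 1826 paper: the fractional integral of order n of the Caputo-type fractional derivative of order n of f recovers f.) -/
/-- The Beta integral `B(1 - n, n)` on the interval from `z` to `x`. -/
theorem integral_sub_rpow_mul_sub_rpow_neg {n z x : ℝ} (hn0 : 0 < n) (hn1 : n < 1) (hzx : z < x) :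
    ∫ a in z..x, (x - a) ^ (n - 1) * (a - z) ^ (-n) = Real.pi / Real.sin (n * Real.pi) := by
  have hB := Complex.betaIntegral_scaled ((1 - n : ℝ) : ℂ) (n : ℂ) (sub_pos.2 hzx)
  have hG := Complex.Gamma_mul_Gamma_eq_betaIntegral (s := ((1 - n : ℝ) : ℂ)) (t := (n : ℂ))
    (by simpa using hn1) (by simpa using hn0)
  have hS := Complex.Gamma_mul_Gamma_one_sub (n : ℂ)
  have h1 : ((1 - n : ℝ) : ℂ) + n = 1 := by push_cast; ring
  rw [h1, Complex.Gamma_one, one_mul, mul_comm] at hG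
  push_cast at hG hB
  rw [hS] at hG
  rw [← hG, show (1 - n + n - 1 : ℂ) = 0 by ring, Complex.cpow_zero, one_mul] at hB
  have hshift : ∫ a in z..x, (x - a) ^ (n - 1) * (a - z) ^ (-n)
      = ∫ a in (0 : ℝ)..(x - z), (x - z - a) ^ (n - 1) * a ^ (-n) := by
    have := intervalIntegral.integral_comp_sub_right (a := z) (b := x)
      (fun a : ℝ => (x - z - a) ^ (n - 1) * a ^ (-n)) z
    rw [sub_self] at this
    rw [← this]
    refine intervalIntegral.integral_congr fun a _ => ?_
    simp only [sub_sub_sub_cancel_right]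
  rw [hshift]
  apply Complex.ofReal_injective
  rw [← intervalIntegral.integral_ofReal]
  push_cast
  rw [mul_comm (n : ℂ), ← hB]
  refine intervalIntegral.integral_congr fun a ha => ?_
  rw [Set.uIcc_of_le (sub_pos.2 hzx).le] at ha
  rw [Complex.ofReal_cpow (sub_nonneg.2 ha.2), Complex.ofReal_cpow ha.1, mul_comm]
  push_cast
  ring_nf

/-- The kernel of Abel's iterated integral, supported on the triangle `0 < z < a ≤ x`. -/
noncomputable def abelKernel (n x : ℝ) : ℝ × ℝ → ℝ :=
  Set.indicator {p | 0 < p.1 ∧ p.1 < p.2 ∧ p.2 ≤ x}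
    fun p => (x - p.2) ^ (n - 1) * (p.2 - p.1) ^ (-n)

theorem measurable_abelKernel (n x : ℝ) : Measurable (abelKernel n x) := by
  refine Measurable.indicator (by fun_prop) ?_
  exact (measurableSet_lt measurable_const measurable_fst).inter
    ((measurableSet_lt measurable_fst measurable_snd).inter
      (measurableSet_le measurable_snd measurable_const))

theorem abelKernel_nonneg (n x : ℝ) (p : ℝ × ℝ) : 0 ≤ abelKernel n x p :=
  Set.indicator_nonneg (fun _ hp => mul_nonneg (Real.rpow_nonneg (sub_nonneg.2 hp.2.2) _)
    (Real.rpow_nonneg (sub_nonneg.2 hp.2.1.le) _)) p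

theorem abelKernel_of_pos {n x z : ℝ} (hz : 0 < z) :
    (fun a => abelKernel n x (z, a))
      = (Set.Ioc z x).indicator fun a => (x - a) ^ (n - 1) * (a - z) ^ (-n) := by
  ext a
  simp [abelKernel, Set.indicator_apply, hz]

theorem abelKernel_of_notMem {n x z : ℝ} (hz : z ∉ Set.Ioo 0 x) (a : ℝ) :
    abelKernel n x (z, a) = 0 :=
  Set.indicator_of_notMem (fun h => hz ⟨h.1, h.2.1.trans_le h.2.2⟩) _

theorem integral_abelKernel {n x : ℝ} (hn0 : 0 < n) (hn1 : n < 1) (z : ℝ) :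
    ∫ a, abelKernel n x (z, a)
      = (Set.Ioo 0 x).indicator (fun _ => Real.pi / Real.sin (n * Real.pi)) z := by
  by_cases hz : z ∈ Set.Ioo 0 x
  · rw [Set.indicator_of_mem hz, abelKernel_of_pos hz.1,
      MeasureTheory.integral_indicator measurableSet_Ioc,
      ← intervalIntegral.integral_of_le hz.2.le, integral_sub_rpow_mul_sub_rpow_neg hn0 hn1 hz.2]
  · simp [Set.indicator_of_notMem hz, abelKernel_of_notMem hz]

theorem integrable_abelKernel {n x : ℝ} (hn0 : 0 < n) (hn1 : n < 1) :
    MeasureTheory.Integrable (abelKernel n x) := by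
  have hsin : 0 < Real.sin (n * Real.pi) := Real.sin_pos_of_pos_of_lt_pi (by positivity)
    (by nlinarith [Real.pi_pos])
  rw [MeasureTheory.Measure.volume_eq_prod, MeasureTheory.integrable_prod_iff
    (measurable_abelKernel n x).aestronglyMeasurable]
  constructor
  · refine .of_forall fun z => ?_
    by_cases hz : z ∈ Set.Ioo 0 x
    · refine MeasureTheory.Integrable.of_integral_ne_zero ?_
      rw [integral_abelKernel hn0 hn1, Set.indicator_of_mem hz]
      positivity
    · simp [abelKernel_of_notMem hz]
  · simp only [Real.norm_of_nonneg (abelKernel_nonneg n x _), integral_abelKernel hn0 hn1]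
    exact (MeasureTheory.integrable_indicator_iff measurableSet_Ioo).2
      (MeasureTheory.integrableOn_const (by simp))

theorem integral_mul_abelKernel {n x : ℝ} (g : ℝ → ℝ) (a : ℝ) :
    ∫ z, g z * abelKernel n x (z, a) = (Set.Ioc 0 x).indicator
      (fun a => (x - a) ^ (n - 1) * ∫ z in (0 : ℝ)..a, g z * (a - z) ^ (-n)) a := by
  by_cases ha : a ∈ Set.Ioc 0 x
  · rw [Set.indicator_of_mem ha, intervalIntegral.integral_of_le ha.1.le,
      MeasureTheory.integral_Ioc_eq_integral_Ioo, ← MeasureTheory.integral_const_mul,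
      ← MeasureTheory.integral_indicator measurableSet_Ioo]
    congr 1 with z
    simp only [abelKernel, Set.indicator_apply, Set.mem_ofPred_eq, Set.mem_Ioo, ha.2, and_true]
    split_ifs <;> ring
  · rw [Set.indicator_of_notMem ha]
    refine MeasureTheory.integral_eq_zero_of_ae (.of_forall fun z => ?_)
    exact mul_eq_zero_of_right _
      (Set.indicator_of_notMem (fun h => ha ⟨h.1.trans h.2.1, h.2.2⟩) _)

/-- Exchanging the order of integration in Abel's iterated integral. -/
theorem integral_rpow_mul_integral_rpow_neg {n x : ℝ} (hn0 : 0 < n) (hn1 : n < 1) (hx : 0 ≤ x)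
    {g : ℝ → ℝ} (hg : ContinuousOn g (Set.Icc 0 x)) :
    ∫ a in (0 : ℝ)..x, (x - a) ^ (n - 1) * ∫ z in (0 : ℝ)..a, g z * (a - z) ^ (-n)
      = Real.pi / Real.sin (n * Real.pi) * ∫ z in (0 : ℝ)..x, g z := by
  obtain ⟨C, hC⟩ := isCompact_Icc.exists_bound_of_continuousOn hg
  set G : ℝ → ℝ := (Set.Icc 0 x).indicator g
  have hGm : MeasureTheory.AEStronglyMeasurable G :=
    (aestronglyMeasurable_indicator_iff measurableSet_Icc).2
      (hg.aestronglyMeasurable measurableSet_Icc)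
  have hGC : ∀ z, ‖G z‖ ≤ |C| := fun z => by
    by_cases hz : z ∈ Set.Icc 0 x
    · simpa only [G, Set.indicator_of_mem hz] using (hC z hz).trans (le_abs_self C)
    · simp [G, Set.indicator_of_notMem hz]
  have hGint : MeasureTheory.Integrable (Function.uncurry fun z a => G z * abelKernel n x (z, a))
      (MeasureTheory.volume.prod MeasureTheory.volume) :=
    (integrable_abelKernel hn0 hn1).bdd_mul (c := |C|) hGm.comp_fst (.of_forall fun p => hGC p.1)
  have hswap := MeasureTheory.integral_integral_swap hGint
  simp only [MeasureTheory.integral_const_mul, integral_abelKernel hn0 hn1,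
    integral_mul_abelKernel] at hswap
  rw [MeasureTheory.integral_indicator measurableSet_Ioc,
    ← intervalIntegral.integral_of_le hx] at hswap
  calc
    _ = ∫ a in (0 : ℝ)..x, (x - a) ^ (n - 1) * ∫ z in (0 : ℝ)..a, G z * (a - z) ^ (-n) := by
      refine intervalIntegral.integral_congr fun a ha => ?_
      rw [Set.uIcc_of_le hx] at ha
      congr 1
      refine intervalIntegral.integral_congr fun z hz => ?_
      rw [Set.uIcc_of_le ha.1] at hz
      simp only [G]
      rw [Set.indicator_of_mem (show z ∈ Set.Icc 0 x from ⟨hz.1, hz.2.trans ha.2⟩)]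
    _ = _ := by
      rw [← hswap, intervalIntegral.integral_of_le hx, MeasureTheory.integral_Ioc_eq_integral_Ioo,
        ← MeasureTheory.integral_const_mul, ← MeasureTheory.integral_indicator measurableSet_Ioo]
      congr 1 with z
      by_cases hz : z ∈ Set.Ioo 0 x
      · simp only [G, Set.indicator_of_mem hz, Set.indicator_of_mem (Set.Ioo_subset_Icc_self hz)]
        ring
      · simp only [Set.indicator_of_notMem hz, mul_zero]


/-- Equation (1) of Abel's 1826 paper: the fractional integral of order n of the
Caputo-type fractional derivative of order n of f recovers f. -/
theorem abel_equation_one_1826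
    (n T : ℝ) (hn0 : 0 < n) (hn1 : n < 1) (hT : 0 < T)
    (f f' : ℝ → ℝ)
    (hderiv : ∀ x ∈ Set.Icc (0 : ℝ) T, HasDerivAt f (f' x) x)
    (hcont : ContinuousOn f' (Set.Icc (0 : ℝ) T))
    (hf0 : f 0 = 0) :
    ∀ x ∈ Set.Icc (0 : ℝ) T,
      f x = (Real.sin (n * Real.pi) / Real.pi) *
        ∫ a in (0 : ℝ)..x, (x - a) ^ (n - 1) *
          ∫ z in (0 : ℝ)..a, f' z * (a - z) ^ (-n) := by
  intro x hx
  have hsub : Set.Icc 0 x ⊆ Set.Icc 0 T := Set.Icc_subset_Icc_right hx.2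
  have hsin : 0 < Real.sin (n * Real.pi) := Real.sin_pos_of_pos_of_lt_pi (by positivity)
    (by nlinarith [Real.pi_pos])
  have hftc : ∫ z in (0 : ℝ)..x, f' z = f x - f 0 := by
    rw [← Set.uIcc_of_le hx.1] at hsub
    exact intervalIntegral.integral_eq_sub_of_hasDerivAt (fun z hz => hderiv z (hsub hz))
      (hcont.mono hsub).intervalIntegrable
  rw [integral_rpow_mul_integral_rpow_neg hn0 hn1 hx.1 (hcont.mono hsub), hftc, hf0, sub_zero]
  field_simp
end

section
/- Let 0 < n < 1, m ≥ 0, c ∈ ℝ, and x > 0. Then (sin(nπ)/π) · ∫_{a=0}^{x} c·a^{m}·(x − a)^{n−1} da = (c·Γ(m + 1) / (Γ(1 − n)·Γ(m + n + 1))) · x^{m+n}, where Γ is the real Gamma function. (Abel's solution of the generalized tautochrone problem when the prescribed time function is ψ(a) = c·a^m: the arclength is proportional to x^{m+n}.) -/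
/-- The real form of Euler's beta integral over `[0, x]`. -/
theorem integral_rpow_mul_sub_rpow {s t x : ℝ} (hs : 0 < s) (ht : 0 < t) (hx : 0 < x) :
    ∫ a in (0 : ℝ)..x, a ^ (s - 1) * (x - a) ^ (t - 1) =
      x ^ (s + t - 1) * (Real.Gamma s * Real.Gamma t / Real.Gamma (s + t)) := by
  have h := Complex.betaIntegral_scaled (s : ℂ) (t : ℂ) hx
  rw [Complex.betaIntegral_eq_Gamma_mul_div _ _ (by simpa) (by simpa)] at h
  apply Complex.ofReal_injective
  rw [← intervalIntegral.integral_ofReal]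
  have hcongr : ∫ a in (0 : ℝ)..x, ((a ^ (s - 1) * (x - a) ^ (t - 1) : ℝ) : ℂ) =
      ∫ a in (0 : ℝ)..x, (a : ℂ) ^ ((s : ℂ) - 1) * ((x : ℂ) - a) ^ ((t : ℂ) - 1) := by
    refine intervalIntegral.integral_congr fun a ha => ?_
    rw [Set.uIcc_of_le hx.le] at ha
    rw [Complex.ofReal_mul, Complex.ofReal_cpow ha.1, Complex.ofReal_cpow (sub_nonneg.2 ha.2)]
    push_cast
    rfl
  rw [hcongr, h]
  simp only [Complex.ofReal_mul, Complex.ofReal_div, ← Complex.Gamma_ofReal,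
    Complex.ofReal_cpow hx.le]
  push_cast
  rfl

/-- Abel's solution of the generalized tautochrone problem for ψ(a) = c·aᵐ:
the arclength is proportional to x^{m+n}. -/
theorem abel_power_time_function
    (n m c x : ℝ) (hn0 : 0 < n) (hn1 : n < 1) (hm : 0 ≤ m) (hx : 0 < x) :
    (Real.sin (n * Real.pi) / Real.pi) *
        (∫ a in (0 : ℝ)..x, c * a ^ m * (x - a) ^ (n - 1))
      = (c * Real.Gamma (m + 1) / (Real.Gamma (1 - n) * Real.Gamma (m + n + 1))) *
          x ^ (m + n) := by
  have hbeta := integral_rpow_mul_sub_rpow (s := m + 1) (by linarith) hn0 hx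
  rw [add_sub_cancel_right, show m + 1 + n - 1 = m + n by ring,
    show m + 1 + n = m + n + 1 by ring] at hbeta
  have hsin : Real.sin (n * Real.pi) / Real.pi = (Real.Gamma n * Real.Gamma (1 - n))⁻¹ := by
    rw [Real.Gamma_mul_Gamma_one_sub, inv_div, mul_comm n]
  have hΓn := (Real.Gamma_pos_of_pos hn0).ne'
  simp_rw [mul_assoc c]
  rw [intervalIntegral.integral_const_mul, hbeta, hsin]
  field_simp
end
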